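/- Fix n ≥ 1 and a₁,…,a_n > 0, and use the roots α_j and the quasi-distance d_φ on ℝ^{n+1} × ℝⁿ. For u = (u₁,…,u_{n+1}) ∈ ℝ^{n+1} and r > 0, let the u-modified box be B_u(r) := [0, e^{ra₁+u₁}] × ⋯ × [0, e^{ra_n+u_n}] × [0, e^{u_{n+1}}] × [0,r]ⁿ, and set ‖u‖ := |u₁| + ⋯ + |u_{n+1}|. Then μ(B_u(r)) = e^{u₁+⋯+u_{n+1}}·(∏_{j=1}^n e^{ra_j})·rⁿ, and there exists a constant C > 0 (depending only on n and a₁,…,a_n) such that for all ε ∈ (0,1], all r ≥ 1, and all u with ‖u‖ ≤ log r: μ(∂_ε B_u(r)) ≤ C·ε·e^{‖u‖}·μ(B_u(r))/r. -/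

import Mathlib

open MeasureTheory
open scoped ENNReal

/-!
STATEMENT 11: volume and boundary-volume estimates for u-modified boxes in the
abelian-by-abelian group G_φ = ℝ^{n+1} ⋊_φ ℝⁿ, modelled on ℝ^{n+1} × ℝⁿ with Lebesgue
measure.
-/

/-- The roots α_j(s) = a_j s_j (j ≤ n) and α_{n+1}(s) = −∑ a_i s_i. -/
noncomputable def root {n : ℕ} (a : Fin n → ℝ) (s : Fin n → ℝ) (j : Fin (n + 1)) : ℝ :=
  if h : (j : ℕ) < n then a ⟨j, h⟩ * s ⟨j, h⟩ else -(∑ i, a i * s i)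

/-- The quasi-distance d_φ on ℝ^{n+1} × ℝⁿ. -/
noncomputable def dphi {n : ℕ} (a : Fin n → ℝ)
    (p q : (Fin (n + 1) → ℝ) × (Fin n → ℝ)) : ℝ :=
  (∑ j : Fin (n + 1), Real.exp (-(root a ((p.2 + q.2) / 2) j)) * |p.1 j - q.1 j|) +
    ⨆ i : Fin n, |p.2 i - q.2 i|

/-- The ε-boundary of A with respect to d_φ. -/
noncomputable def phiBdry {n : ℕ} (a : Fin n → ℝ) (ε : ℝ)
    (A : Set ((Fin (n + 1) → ℝ) × (Fin n → ℝ))) :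
    Set ((Fin (n + 1) → ℝ) × (Fin n → ℝ)) :=
  {p | (∃ q ∈ A, dphi a p q ≤ ε) ∧ (∃ q ∉ A, dphi a p q ≤ ε)}

/-- The u-modified box B_u(r) = ∏_{j≤n} [0, e^{ra_j+u_j}] × [0, e^{u_{n+1}}] × [0,r]ⁿ. -/
noncomputable def modBox {n : ℕ} (a : Fin n → ℝ) (u : Fin (n + 1) → ℝ) (r : ℝ) :
    Set ((Fin (n + 1) → ℝ) × (Fin n → ℝ)) :=
  {p | (∀ j : Fin (n + 1),
          p.1 j ∈ Set.Icc 0 (Real.exp ((if h : (j : ℕ) < n then r * a ⟨j, h⟩ else 0) + u j)))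
        ∧ ∀ i : Fin n, p.2 i ∈ Set.Icc 0 r}

lemma mb_lintegral_pi : ∀ (n : ℕ) (f : Fin n → ℝ → ℝ≥0∞), (∀ i, Measurable (f i)) →
    ∫⁻ s : Fin n → ℝ, ∏ i, f i (s i) = ∏ i, ∫⁻ t, f i t := by
  intro n
  induction n with
  | zero => intro f _; simp [volume_pi]
  | succ n ih =>
    intro f hf
    rw [← ((volume_preserving_piFinSuccAbove (fun _ => ℝ) (0 : Fin (n+1))).symm).lintegral_comp_emb
      (MeasurableEquiv.measurableEmbedding _)]
    simp only [MeasurableEquiv.piFinSuccAbove_symm_apply, Fin.insertNthEquiv,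
      Fin.prod_univ_succ, Fin.insertNth_zero, Equiv.coe_fn_mk, Fin.cons_succ, Fin.cons_zero,
      Fin.zero_succAbove]
    rw [Measure.volume_eq_prod]
    have := lintegral_prod_mul (μ := (volume : Measure ℝ)) (ν := (volume : Measure (Fin n → ℝ)))
      (f := f 0) (g := fun s => ∏ i : Fin n, f i.succ (s i)) (hf 0).aemeasurable
      (by refine Measurable.aemeasurable ?_
          exact Finset.measurable_prod _ (fun i _ => (hf i.succ).comp (measurable_pi_apply i)))
    rw [← ih (fun i => f i.succ) (fun i => hf _)]
    exact this

/-- A piece of the boundary cover. -/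
def mbPiece {n : ℕ} (j : Fin (n+1)) (i0 : Fin n) (c W : Fin (n+1) → ℝ) (F : ℝ → ℝ) (r : ℝ) :
    Set ((Fin (n + 1) → ℝ) × (Fin n → ℝ)) :=
  {p | (∀ k, |p.1 k - c k| ≤ W k * (if k = j then F (p.2 i0) else 1)) ∧
    ∀ i, i ≠ i0 → |p.2 i - r/2| ≤ 3 * r / 2}

lemma mb_vol_abs (c w : ℝ) : volume {x : ℝ | |x - c| ≤ w} = ENNReal.ofReal (2 * w) := by
  have : {x : ℝ | |x - c| ≤ w} = Metric.closedBall c w := by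
    ext x; simp [Real.dist_eq]
  rw [this, Real.volume_closedBall]

lemma mbPiece_volume {n : ℕ} (j : Fin (n+1)) (i0 : Fin n) (c W : Fin (n+1) → ℝ) (F : ℝ → ℝ)
    (hF : Measurable F) (hF0 : ∀ t, 0 ≤ F t) (hW : ∀ k, 0 ≤ W k) (r I : ℝ) (hr : 0 ≤ r)
    (hI0 : 0 ≤ I)
    (hI : ∫⁻ t, ENNReal.ofReal (F t) ≤ ENNReal.ofReal I) :
    volume (mbPiece j i0 c W F r) ≤
      ENNReal.ofReal ((∏ k, (2 * W k)) * ((3 * r) ^ (n - 1) * I)) := by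
  have hm : MeasurableSet (mbPiece j i0 c W F r) := by
    unfold mbPiece
    rw [Set.ofPred_and, Set.ofPred_forall, Set.ofPred_forall]
    refine MeasurableSet.inter (MeasurableSet.iInter fun k => ?_)
      (MeasurableSet.iInter fun i => ?_)
    · refine measurableSet_le (by fun_prop) ?_
      by_cases h : k = j
      · simp only [h, if_true]; fun_prop
      · simp only [h, if_false]; fun_prop
    · rw [Set.ofPred_forall]
      refine MeasurableSet.iInter fun _ => ?_
      exact measurableSet_le (by fun_prop) (by fun_prop)
  let J : Set ℝ := {t | |t - r/2| ≤ 3 * r / 2}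
  have hJ : MeasurableSet J := measurableSet_le (by fun_prop) (by fun_prop)
  let g : Fin n → ℝ → ℝ≥0∞ := fun i =>
    if i = i0 then fun t => ENNReal.ofReal (F t) else J.indicator (fun _ => 1)
  have hg : ∀ i, Measurable (g i) := by
    intro i
    by_cases h : i = i0
    · simp only [g, h, if_true]; fun_prop
    · simp only [g, h, if_false]; exact measurable_const.indicator hJ
  have hP : 0 ≤ ∏ k, (2 * W k) := Finset.prod_nonneg fun k _ => by have := hW k; positivity
  rw [Measure.volume_eq_prod, Measure.prod_apply_symm hm]
  calc ∫⁻ s, volume ((fun x => (x, s)) ⁻¹' mbPiece j i0 c W F r)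
      ≤ ∫⁻ s : Fin n → ℝ, ENNReal.ofReal (∏ k, (2 * W k)) * ∏ i, g i (s i) := by
        refine lintegral_mono fun s => ?_
        by_cases hs : ∀ i, i ≠ i0 → s i ∈ J
        · have h1 : ((fun x => (x, s)) ⁻¹' mbPiece j i0 c W F r) ⊆
              Set.pi Set.univ (fun k => {x : ℝ | |x - c k| ≤ W k * (if k = j then F (s i0) else 1)}) := by
            intro x hx k _
            exact hx.1 k
          refine (measure_mono h1).trans ?_
          rw [volume_pi_pi]
          simp only [mb_vol_abs]
          have h2 : ∏ i, g i (s i) = ENNReal.ofReal (F (s i0)) := by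
            rw [Finset.prod_eq_single i0]
            · simp [g]
            · intro i _ hi
              simp [g, hi, hs i hi]
            · simp
          rw [h2, ← ENNReal.ofReal_mul hP, ← ENNReal.ofReal_prod_of_nonneg]
          · apply le_of_eq
            congr 1
            simp only [← mul_assoc]
            rw [Finset.prod_mul_distrib, Finset.prod_ite_eq']
            simp
          · intro k _
            have := hW k
            have := hF0 (s i0)
            split_ifs <;> positivity
        · have : ((fun x => (x, s)) ⁻¹' mbPiece j i0 c W F r) = ∅ := by
            ext x
            simp only [Set.mem_preimage, Set.mem_empty_iff_false, iff_false]
            intro hx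
            exact hs hx.2
          rw [this]; simp
    _ = ENNReal.ofReal (∏ k, (2 * W k)) * ∏ i, ∫⁻ t, g i t := by
        rw [lintegral_const_mul, mb_lintegral_pi n g hg]
        exact Finset.measurable_prod _ (fun i _ => (hg i).comp (measurable_pi_apply i))
    _ ≤ _ := by
        rw [ENNReal.ofReal_mul hP]
        gcongr
        rw [← Finset.prod_erase_mul _ _ (Finset.mem_univ i0), ENNReal.ofReal_mul (by positivity)]
        refine mul_le_mul' ?_ ?_
        · apply le_of_eq
          rw [Finset.prod_congr rfl (g := fun _ => ENNReal.ofReal (3 * r))]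
          · rw [Finset.prod_const, Finset.card_erase_of_mem (Finset.mem_univ i0),
              ENNReal.ofReal_pow (by positivity)]
            simp
          · intro i hi
            have hi' : i ≠ i0 := Finset.ne_of_mem_erase hi
            simp only [g, hi', if_false]
            rw [lintegral_indicator hJ]
            simp only [lintegral_const, one_mul, Measure.restrict_apply_univ, J]
            rw [mb_vol_abs]
            congr 1; ring
        · simpa [g] using hI

lemma mb_exp_int (b c : ℝ) (hb : 0 < b) :
    ∫⁻ t, ENNReal.ofReal ((Set.Iic (c+1)).indicator (fun t => Real.exp (b * (t - c))) t) ≤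
      ENNReal.ofReal (Real.exp b / b) := by
  have h : ∀ t, ENNReal.ofReal ((Set.Iic (c+1)).indicator (fun t => Real.exp (b * (t - c))) t) =
      (Set.Iic (c+1)).indicator (fun t => ENNReal.ofReal (Real.exp (-(b*c)) * Real.exp (b * t))) t := by
    intro t
    by_cases ht : t ∈ Set.Iic (c+1)
    · rw [Set.indicator_of_mem ht, Set.indicator_of_mem ht, ← Real.exp_add]; congr 2; ring
    · simp [Set.indicator_of_notMem ht]
  simp_rw [h]
  rw [lintegral_indicator measurableSet_Iic, ← ofReal_integral_eq_lintegral_ofReal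
    ((integrableOn_exp_mul_Iic hb _).const_mul _) (Filter.Eventually.of_forall fun t => by positivity),
    integral_const_mul, integral_exp_mul_Iic hb, ← mul_div_assoc, ← Real.exp_add]
  apply le_of_eq; congr 3; ring

lemma mb_exp_int' (b c : ℝ) (hb : 0 < b) :
    ∫⁻ t, ENNReal.ofReal ((Set.Ici (-c-1)).indicator (fun t => Real.exp (b * (-t - c))) t) ≤
      ENNReal.ofReal (Real.exp b / b) := by
  refine le_trans (le_of_eq ?_) (mb_exp_int b c hb)
  rw [← lintegral_neg_eq_self]
  refine lintegral_congr fun t => ?_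
  have : (-t ∈ Set.Ici (-c-1)) ↔ t ∈ Set.Iic (c+1) := by
    simp only [Set.mem_Ici, Set.mem_Iic]; constructor <;> intro h <;> linarith
  by_cases ht : t ∈ Set.Iic (c+1)
  · rw [Set.indicator_of_mem ht, Set.indicator_of_mem (this.2 ht)]; simp
  · rw [Set.indicator_of_notMem ht, Set.indicator_of_notMem (fun h => ht (this.1 h))]

lemma mb_near {x y y' L δ : ℝ} (hy : y ∈ Set.Icc 0 L) (hy' : y' ∉ Set.Icc 0 L)
    (h : |x - y| ≤ δ) (h' : |x - y'| ≤ δ) : |x - 0| ≤ δ ∨ |x - L| ≤ δ := by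
  rw [Set.mem_Icc] at hy hy'
  rw [abs_le] at h h'
  simp only [abs_le]
  by_cases h0 : 0 ≤ y'
  · have : L < y' := by
      by_contra hc; exact hy' ⟨h0, not_lt.1 hc⟩
    right; constructor <;> linarith
  · left; constructor <;> linarith

/-- The exponents of the box. -/
noncomputable def mbLam {n : ℕ} (a : Fin n → ℝ) (r : ℝ) (j : Fin (n+1)) : ℝ :=
  if h : (j : ℕ) < n then r * a ⟨j, h⟩ else 0

lemma mb_root_le {n : ℕ} (a : Fin n → ℝ) (ha : ∀ i, 0 < a i) (r : ℝ)
    (k : Fin (n+1)) (s m : Fin n → ℝ) (hs : ∀ i, -1 ≤ s i ∧ s i ≤ r + 1)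
    (hm : ∀ i, |m i - s i| ≤ 1) :
    root a m k ≤ 2 * (∑ i, a i) + mbLam a r k := by
  unfold root mbLam
  split_ifs with h
  · have h1 : a ⟨k, h⟩ ≤ ∑ i, a i := Finset.single_le_sum (fun i _ => (ha i).le) (Finset.mem_univ _)
    have h2 := abs_le.1 (hm ⟨k, h⟩)
    have h3 := hs ⟨k, h⟩
    have h4 := ha ⟨k, h⟩
    have : a ⟨k, h⟩ * m ⟨k, h⟩ ≤ a ⟨k, h⟩ * (r + 2) := by
      apply mul_le_mul_of_nonneg_left _ h4.le; linarith
    nlinarith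
  · rw [← Finset.sum_neg_distrib, Finset.mul_sum, add_zero]
    refine Finset.sum_le_sum fun i _ => ?_
    have h2 := abs_le.1 (hm i)
    have h3 := hs i
    have h4 := ha i
    nlinarith

lemma mb_root_decay {n : ℕ} (hn : 1 ≤ n) (a : Fin n → ℝ) (ha : ∀ i, 0 < a i) (r : ℝ)
    (k : Fin (n+1)) :
    ∃ (i0 : Fin n) (F : ℝ → ℝ), Measurable F ∧ (∀ t, 0 ≤ F t) ∧
      (∫⁻ t, ENNReal.ofReal (F t) ≤ ENNReal.ofReal (Real.exp (a i0) / a i0)) ∧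
      ∀ s m : Fin n → ℝ, (∀ i, -1 ≤ s i ∧ s i ≤ r + 1) → (∀ i, |m i - s i| ≤ 1) →
        Real.exp (root a m k) ≤
          Real.exp (2 * (∑ i, a i)) * Real.exp (mbLam a r k) * F (s i0) := by
  by_cases h : (k : ℕ) < n
  · refine ⟨⟨k, h⟩, (Set.Iic (r+1)).indicator (fun t => Real.exp (a ⟨k, h⟩ * (t - r))),
      Measurable.indicator (by fun_prop) measurableSet_Iic,
      fun t => Set.indicator_nonneg (fun _ _ => (Real.exp_pos _).le) _,
      mb_exp_int _ _ (ha _), ?_⟩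
    intro s m hs hm
    have h1 : a ⟨k, h⟩ ≤ ∑ i, a i := Finset.single_le_sum (fun i _ => (ha i).le) (Finset.mem_univ _)
    have h2 := abs_le.1 (hm ⟨k, h⟩)
    have h3 := hs ⟨k, h⟩
    have h4 := ha ⟨k, h⟩
    rw [Set.indicator_of_mem (by simpa using h3.2), ← Real.exp_add, ← Real.exp_add,
      Real.exp_le_exp]
    simp only [root, mbLam, h, dif_pos]
    nlinarith
  · refine ⟨⟨0, hn⟩, (Set.Ici (-0-1)).indicator (fun t => Real.exp (a ⟨0, hn⟩ * (-t - 0))),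
      Measurable.indicator (by fun_prop) measurableSet_Ici,
      fun t => Set.indicator_nonneg (fun _ _ => (Real.exp_pos _).le) _,
      mb_exp_int' _ _ (ha _), ?_⟩
    intro s m hs hm
    rw [Set.indicator_of_mem (by simpa using (hs ⟨0, hn⟩).1), ← Real.exp_add, ← Real.exp_add,
      Real.exp_le_exp]
    simp only [root, mbLam, h, dif_neg, not_false_eq_true]
    rw [← Finset.sum_neg_distrib, Finset.mul_sum,
      ← Finset.add_sum_erase _ _ (Finset.mem_univ (⟨0, hn⟩ : Fin n)),
      ← Finset.add_sum_erase (Finset.univ) (fun i => 2 * a i) (Finset.mem_univ (⟨0, hn⟩ : Fin n))]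
    have h1 : ∑ x ∈ Finset.univ.erase (⟨0, hn⟩ : Fin n), -(a x * m x) ≤
        ∑ x ∈ Finset.univ.erase (⟨0, hn⟩ : Fin n), 2 * a x := by
      refine Finset.sum_le_sum fun i _ => ?_
      have h2 := abs_le.1 (hm i)
      have h3 := hs i
      have h4 := ha i
      nlinarith
    have h2 := abs_le.1 (hm ⟨0, hn⟩)
    have h3 := hs ⟨0, hn⟩
    have h4 := ha ⟨0, hn⟩
    nlinarith

lemma mb_dphi {n : ℕ} (a : Fin n → ℝ) (p q : (Fin (n + 1) → ℝ) × (Fin n → ℝ)) (ε : ℝ)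
    (h : dphi a p q ≤ ε) :
    (∀ k, |p.1 k - q.1 k| ≤ ε * Real.exp (root a ((p.2 + q.2) / 2) k)) ∧
    ∀ i, |p.2 i - q.2 i| ≤ ε := by
  unfold dphi at h
  have hbdd : BddAbove (Set.range fun i : Fin n => |p.2 i - q.2 i|) := (Set.finite_range _).bddAbove
  have h1 : 0 ≤ ⨆ i : Fin n, |p.2 i - q.2 i| := Real.iSup_nonneg fun i => abs_nonneg _
  have h2 : ∀ k ∈ Finset.univ, 0 ≤ Real.exp (-(root a ((p.2 + q.2) / 2) k)) * |p.1 k - q.1 k| :=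
    fun k _ => by positivity
  constructor
  · intro k
    have h3 := Finset.single_le_sum h2 (Finset.mem_univ k)
    have h4 : Real.exp (-(root a ((p.2 + q.2) / 2) k)) * |p.1 k - q.1 k| ≤ ε := by linarith
    rw [Real.exp_neg, inv_mul_le_iff₀ (Real.exp_pos _)] at h4
    linarith
  · intro i
    have h3 := Finset.sum_nonneg h2
    have h4 := le_ciSup hbdd i
    linarith

lemma modBox_volume {n : ℕ} (a : Fin n → ℝ) (u : Fin (n + 1) → ℝ) (r : ℝ) (hr : 0 < r) :
    volume (modBox a u r) =
      ENNReal.ofReal ((∏ k, Real.exp (mbLam a r k + u k)) * r ^ n) := by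
  have : modBox a u r =
      (Set.pi Set.univ fun k => Set.Icc 0 (Real.exp (mbLam a r k + u k))) ×ˢ
      (Set.pi Set.univ fun _ : Fin n => Set.Icc 0 r) := by
    ext p
    simp only [modBox, mbLam, Set.mem_prod, Set.mem_pi, Set.mem_univ, true_imp_iff]
    rfl
  rw [this, Measure.volume_eq_prod, Measure.prod_prod, volume_pi_pi, volume_pi_pi,
    ENNReal.ofReal_mul (by positivity), ENNReal.ofReal_prod_of_nonneg (fun _ _ => by positivity),
    ENNReal.ofReal_pow hr.le]
  simp

lemma mb_prod {n : ℕ} (a : Fin n → ℝ) (u : Fin (n + 1) → ℝ) (r : ℝ) :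
    (∏ k, Real.exp (mbLam a r k + u k)) =
      Real.exp (∑ j, u j) * (∏ i : Fin n, Real.exp (r * a i)) := by
  simp only [Real.exp_add, Finset.prod_mul_distrib, Real.exp_sum]
  rw [mul_comm]
  congr 1
  rw [Fin.prod_univ_castSucc]
  simp [mbLam]

lemma mb_bdry {n : ℕ} (hn : 1 ≤ n) (a : Fin n → ℝ) (ha : ∀ i, 0 < a i) (ε r : ℝ)
    (hε : 0 < ε) (hε1 : ε ≤ 1) (hr : 1 ≤ r) (u : Fin (n + 1) → ℝ) :
    volume (phiBdry a ε (modBox a u r)) ≤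
      ENNReal.ofReal ((4 * n + 2) * ((∏ k, (2 * (2 * Real.exp (2 * ∑ i, a i) *
        Real.exp |u k| * Real.exp (mbLam a r k + u k)))) *
        ((3 * r) ^ (n - 1) * (ε * (2 + ∑ i, Real.exp (a i) / a i))))) := by
  set E := Real.exp (2 * ∑ i, a i) with hE
  set L : Fin (n+1) → ℝ := fun k => Real.exp (mbLam a r k + u k) with hL
  set W : Fin (n+1) → ℝ := fun k => 2 * E * Real.exp |u k| * L k with hWd
  set Q := 2 + ∑ i, Real.exp (a i) / a i with hQ
  have hE1 : 1 ≤ E := by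
    rw [hE]; apply Real.one_le_exp
    have := Finset.sum_nonneg (fun i (_ : i ∈ Finset.univ) => (ha i).le)
    linarith
  have hLpos : ∀ k, 0 < L k := fun k => Real.exp_pos _
  have hW0 : ∀ k, 0 ≤ W k := fun k => by have := hLpos k; positivity
  have hLW : ∀ k, E * L k ≤ W k / 2 := by
    intro k
    have h1 : (1:ℝ) ≤ Real.exp |u k| := Real.one_le_exp (abs_nonneg _)
    have h2 : 0 < E * L k := mul_pos (by linarith) (hLpos k)
    simp only [hWd]; nlinarith
  have hlamW : ∀ k, E * Real.exp (mbLam a r k) ≤ W k / 2 := by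
    intro k
    have h1 : Real.exp (mbLam a r k) ≤ Real.exp |u k| * L k := by
      simp only [hL]
      rw [← Real.exp_add, Real.exp_le_exp]
      have := neg_abs_le (u k); linarith
    have h2 : E * Real.exp (mbLam a r k) ≤ E * (Real.exp |u k| * L k) :=
      mul_le_mul_of_nonneg_left h1 (by linarith)
    simp only [hWd]; linarith
  have hQ0 : ∀ i, 0 ≤ Real.exp (a i) / a i := fun i => by have := ha i; positivity
  have hQ2 : 2 ≤ Q := by
    have := Finset.sum_nonneg (fun i (_ : i ∈ Finset.univ) => hQ0 i); linarith
  have hQi : ∀ i, Real.exp (a i) / a i ≤ Q := by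
    intro i
    have := Finset.single_le_sum (fun i (_ : i ∈ Finset.univ) => hQ0 i) (Finset.mem_univ i)
    linarith
  choose I F hFm hF0 hFI hF using mb_root_decay hn a ha r
  let cen : Fin (n+1) → Bool → Fin (n+1) → ℝ := fun j b k =>
    if k = j then (if b then L j else 0) else L k / 2
  let T : (Fin n × Bool) ⊕ (Fin (n+1) × Bool) → Set ((Fin (n + 1) → ℝ) × (Fin n → ℝ)) :=
    Sum.elim
      (fun x => mbPiece 0 x.1 (fun k => L k / 2) W
        ({t : ℝ | |t - (if x.2 then r else 0)| ≤ ε}.indicator (fun _ => 1)) r)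
      (fun x => mbPiece x.1 (I x.1) (cen x.1 x.2) W (fun t => ε * F x.1 t) r)
  have hT : ∀ x, volume (T x) ≤ ENNReal.ofReal ((∏ k, (2 * W k)) * ((3 * r) ^ (n - 1) * (ε * Q))) := by
    have hεQ : 0 ≤ ε * Q := by positivity
    rintro (⟨i, b⟩ | ⟨j, b⟩)
    · simp only [T, Sum.elim_inl]
      have hms : MeasurableSet {t : ℝ | |t - (if b then r else 0)| ≤ ε} :=
        measurableSet_le (by fun_prop) (by fun_prop)
      refine mbPiece_volume _ _ _ _ _ (measurable_const.indicator hms)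
        (fun t => Set.indicator_nonneg (fun _ _ => zero_le_one) _) hW0 _ _ (by linarith) hεQ ?_
      have h : ∀ t, ENNReal.ofReal ({t : ℝ | |t - (if b then r else 0)| ≤ ε}.indicator (fun _ => (1:ℝ)) t) =
          {t : ℝ | |t - (if b then r else 0)| ≤ ε}.indicator (fun _ => 1) t := by
        intro t
        by_cases ht : t ∈ {t : ℝ | |t - (if b then r else 0)| ≤ ε}
        · rw [Set.indicator_of_mem ht, Set.indicator_of_mem ht]; simp
        · rw [Set.indicator_of_notMem ht, Set.indicator_of_notMem ht]; simp
      simp_rw [h]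
      rw [lintegral_indicator hms]
      simp only [lintegral_const, one_mul, Measure.restrict_apply_univ]
      rw [mb_vol_abs]
      apply ENNReal.ofReal_le_ofReal; nlinarith
    · simp only [T, Sum.elim_inr]
      refine mbPiece_volume _ _ _ _ _ ((hFm j).const_mul ε)
        (fun t => mul_nonneg hε.le (hF0 j t)) hW0 _ _ (by linarith) hεQ ?_
      simp_rw [ENNReal.ofReal_mul hε.le]
      rw [lintegral_const_mul _ (hFm j).ennreal_ofReal]
      gcongr
      exact (hFI j).trans (ENNReal.ofReal_le_ofReal (hQi _))
  have hcov : phiBdry a ε (modBox a u r) ⊆ ⋃ x, T x := by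
    rintro p ⟨⟨q, hq, hpq⟩, ⟨q', hq', hpq'⟩⟩
    obtain ⟨hqx, hqs⟩ := mb_dphi a p q ε hpq
    obtain ⟨hqx', hqs'⟩ := mb_dphi a p q' ε hpq'
    have hs : ∀ i, -1 ≤ p.2 i ∧ p.2 i ≤ r + 1 := by
      intro i
      have h1 := abs_le.1 (hqs i)
      have h2 := hq.2 i
      rw [Set.mem_Icc] at h2
      constructor <;> linarith
    have hmid : ∀ q : (Fin (n + 1) → ℝ) × (Fin n → ℝ), (∀ i, |p.2 i - q.2 i| ≤ ε) →
        ∀ i, |((p.2 + q.2) / 2) i - p.2 i| ≤ 1 := by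
      intro q h i
      have h1 := abs_le.1 (h i)
      have h2 : ((p.2 + q.2) / 2) i = (p.2 i + q.2 i) / 2 := rfl
      rw [h2, abs_le]
      constructor <;> linarith
    have hx : ∀ k, |p.1 k - L k / 2| ≤ W k := by
      intro k
      have h1 := hqx k
      have h2 : Real.exp (root a ((p.2 + q.2) / 2) k) ≤ W k / 2 := by
        refine le_trans ?_ (hlamW k)
        rw [hE, ← Real.exp_add, Real.exp_le_exp]
        exact mb_root_le a ha r k p.2 _ hs (hmid q hqs)
      have h3 := hq.1 k
      change q.1 k ∈ Set.Icc 0 (L k) at h3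
      rw [Set.mem_Icc] at h3
      have h4 : |p.1 k - q.1 k| ≤ W k / 2 := by
        refine h1.trans (le_trans ?_ h2)
        have := Real.exp_pos (root a ((p.2 + q.2) / 2) k)
        nlinarith
      have h5 : L k ≤ W k / 2 := by
        have := hLW k; have := hLpos k; nlinarith
      rw [abs_le] at h4 ⊢
      constructor <;> linarith
    have hsr : ∀ i, |p.2 i - r / 2| ≤ 3 * r / 2 := by
      intro i
      have := hs i
      rw [abs_le]; constructor <;> linarith
    rw [Set.mem_iUnion]
    have hor : (∃ i, q'.2 i ∉ Set.Icc 0 r) ∨ ∃ k, q'.1 k ∉ Set.Icc 0 (L k) := by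
      by_contra hc
      push Not at hc
      exact hq' ⟨hc.2, hc.1⟩
    rcases hor with ⟨i, hi⟩ | ⟨j, hj⟩
    · have key : ∀ b : Bool, |p.2 i - (if b then r else 0)| ≤ ε → ∃ x, p ∈ T x := by
        intro b hb
        refine ⟨Sum.inl (i, b), ?_, fun i _ => hsr i⟩
        intro k
        have : p.2 i ∈ {t : ℝ | |t - (if b then r else 0)| ≤ ε} := hb
        simp only [Set.indicator_of_mem this, ite_self, mul_one]
        exact hx k
      rcases mb_near (hq.2 i) hi (hqs i) (hqs' i) with h | h
      · exact key false (by simpa using h)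
      · exact key true (by simpa using h)
    · have hd : ∀ q : (Fin (n + 1) → ℝ) × (Fin n → ℝ), (∀ i, |p.2 i - q.2 i| ≤ ε) →
          |p.1 j - q.1 j| ≤ ε * Real.exp (root a ((p.2 + q.2) / 2) j) →
          |p.1 j - q.1 j| ≤ W j * (ε * F j (p.2 (I j))) := by
        intro q h1 h2
        refine h2.trans ?_
        have h3 := hF j p.2 _ hs (hmid q h1)
        have h4 := hF0 j (p.2 (I j))
        have h5 : E * Real.exp (mbLam a r j) * F j (p.2 (I j)) ≤ W j * F j (p.2 (I j)) :=
          mul_le_mul_of_nonneg_right (by have := hlamW j; have := hW0 j; linarith) h4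
        have h6 := mul_le_mul_of_nonneg_left (h3.trans h5) hε.le
        linarith
      have key : ∀ b : Bool, |p.1 j - (if b then L j else 0)| ≤ W j * (ε * F j (p.2 (I j))) →
          ∃ x, p ∈ T x := by
        intro b hb
        refine ⟨Sum.inr (j, b), ?_, fun i _ => hsr i⟩
        intro k
        by_cases hk : k = j
        · subst hk; simpa [cen] using hb
        · simpa [cen, hk] using hx k
      rcases mb_near (hq.1 j) hj (hd q hqs (hqx j)) (hd q' hqs' (hqx' j)) with h | h
      · exact key false (by simpa using h)
      · exact key true h
  refine (measure_mono hcov).trans ((measure_iUnion_fintype_le _ _).trans ?_)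
  refine (Finset.sum_le_sum fun x _ => hT x).trans ?_
  rw [Finset.sum_const, nsmul_eq_mul, ENNReal.ofReal_mul (p := 4 * (n : ℝ) + 2) (by positivity)]
  refine mul_le_mul' ?_ le_rfl
  rw [show ((4 * n + 2 : ℝ)) = ((4 * n + 2 : ℕ) : ℝ) by push_cast; ring, ENNReal.ofReal_natCast]
  simp only [Finset.card_univ, Fintype.card_sum, Fintype.card_prod, Fintype.card_fin,
    Fintype.card_bool]
  norm_cast
  lia

theorem modified_box_volume_and_boundary (n : ℕ) (hn : 1 ≤ n) (a : Fin n → ℝ)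
    (ha : ∀ i, 0 < a i) :
    -- volume of the u-modified box:
    (∀ (u : Fin (n + 1) → ℝ) (r : ℝ), 0 < r →
      volume (modBox a u r) =
        ENNReal.ofReal
          (Real.exp (∑ j, u j) * (∏ i : Fin n, Real.exp (r * a i)) * r ^ n)) ∧
    -- boundary estimate μ(∂_ε B_u(r)) = O(ε e^{‖u‖} μ(B_u(r))/r):
    ∃ C : ℝ, 0 < C ∧ ∀ ε : ℝ, 0 < ε → ε ≤ 1 → ∀ r : ℝ, 1 ≤ r →
      ∀ u : Fin (n + 1) → ℝ, (∑ j, |u j|) ≤ Real.log r →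
        volume (phiBdry a ε (modBox a u r)) ≤
          ENNReal.ofReal (C * ε * Real.exp (∑ j, |u j|) / r) * volume (modBox a u r) := by
  refine ⟨fun u r hr => by rw [modBox_volume a u r hr, mb_prod], ?_⟩
  have hQ : 0 ≤ ∑ i, Real.exp (a i) / a i :=
    Finset.sum_nonneg fun i _ => by have := ha i; positivity
  refine ⟨(4 * n + 2) * (4 * Real.exp (2 * ∑ i, a i)) ^ (n + 1) * 3 ^ (n - 1) *
    (2 + ∑ i, Real.exp (a i) / a i), by positivity, ?_⟩
  intro ε hε hε1 r hr u _
  have hr0 : 0 < r := by linarith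
  refine (mb_bdry hn a ha ε r hε hε1 hr u).trans (le_of_eq ?_)
  rw [modBox_volume a u r hr0, ← ENNReal.ofReal_mul (by positivity)]
  congr 1
  have h1 : ∏ k, (2 * (2 * Real.exp (2 * ∑ i, a i) *
        Real.exp |u k| * Real.exp (mbLam a r k + u k))) =
      (4 * Real.exp (2 * ∑ i, a i)) ^ (n + 1) * Real.exp (∑ j, |u j|) *
        ∏ k, Real.exp (mbLam a r k + u k) := by
    rw [Real.exp_sum]
    have : (4 * Real.exp (2 * ∑ i, a i)) ^ (n + 1) =
      ∏ _k : Fin (n+1), (4 * Real.exp (2 * ∑ i, a i)) := by simp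
    rw [mul_assoc, ← Finset.prod_mul_distrib, this, ← Finset.prod_mul_distrib]
    refine Finset.prod_congr rfl fun k _ => ?_
    ring
  have h2 : r ^ n = r ^ (n - 1) * r := by
    rw [← pow_succ]; congr 1; lia
  rw [h1, h2, mul_pow 3 r]
  field_simp
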